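/- For every prime p ≥ 3, I(p,2) = p; that is, the maximum cardinality of a subset of (ℤ/pℤ)² whose points are pairwise at integral distance equals p. -/

import Mathlib

/-- Two points `u, v ∈ (ℤ/nℤ)^m` are at integral distance if there exists
`d ∈ ℤ/nℤ` with `∑ i, (u i - v i)^2 = d^2`. -/
def IntegralDistance (n : ℕ) {m : ℕ} (u v : Fin m → ZMod n) : Prop :=
  ∃ d : ZMod n, ∑ i, (u i - v i) ^ 2 = d ^ 2

/-- `maxIntegralCard n m` is the maximum cardinality of a subset of `(ℤ/nℤ)^m`
whose points are pairwise at integral distance. -/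
noncomputable def maxIntegralCard (n m : ℕ) : ℕ :=
  sSup {k : ℕ | ∃ S : Finset (Fin m → ZMod n),
    (∀ u ∈ S, ∀ v ∈ S, IntegralDistance n u v) ∧ S.card = k}

theorem integral_card_le (p : ℕ) [Fact p.Prime] (hp2 : p ≠ 2)
    (S : Finset (Fin 2 → ZMod p)) (hS : ∀ u ∈ S, ∀ v ∈ S, IntegralDistance p u v) :
    S.card ≤ p := by
  obtain ⟨c, hc⟩ := FiniteField.exists_nonsquare (F := ZMod p)
    (by rw [ZMod.ringChar_zmod_n]; exact hp2)
  obtain ⟨a, b, hab⟩ := ZMod.sq_add_sq p c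
  have hc0 : c ≠ 0 := fun h => hc (h ▸ IsSquare.zero)
  have key : Set.InjOn (fun u : Fin 2 → ZMod p => b * u 0 - a * u 1) S := by
    intro u hu v hv h
    obtain ⟨e, he⟩ := hS u hu v hv
    rw [Fin.sum_univ_two] at he
    have h1 : b * (u 0 - v 0) - a * (u 1 - v 1) = 0 := by
      have h' : b * u 0 - a * u 1 = b * v 0 - a * v 1 := h
      linear_combination h'
    have h2 : e ^ 2 * c = (a * (u 0 - v 0) + b * (u 1 - v 1)) ^ 2 := by
      rw [← he, ← hab]
      linear_combination (b * (u 0 - v 0) - a * (u 1 - v 1)) * h1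
    have he0 : e = 0 := by
      by_contra hne
      refine hc ⟨(a * (u 0 - v 0) + b * (u 1 - v 1)) / e, ?_⟩
      field_simp
      linear_combination h2
    have h3 : a * (u 0 - v 0) + b * (u 1 - v 1) = 0 := by
      rw [he0] at h2
      exact pow_eq_zero_iff (two_ne_zero) |>.1 (by rw [← h2]; ring)
    have h4 : c * (u 0 - v 0) = 0 := by
      rw [← hab]; linear_combination a * h3 + b * h1
    have h5 : c * (u 1 - v 1) = 0 := by
      rw [← hab]; linear_combination b * h3 - a * h1
    have h6 := sub_eq_zero.1 ((mul_eq_zero.1 h4).resolve_left hc0)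
    have h7 := sub_eq_zero.1 ((mul_eq_zero.1 h5).resolve_left hc0)
    funext i
    fin_cases i
    · exact h6
    · exact h7
  calc S.card ≤ (Finset.univ : Finset (ZMod p)).card :=
        Finset.card_le_card_of_injOn _ (fun _ _ => Finset.mem_coe.2 (Finset.mem_univ _)) key
    _ = p := by rw [Finset.card_univ, ZMod.card]

theorem maxIntegralCard_prime_plane (p : ℕ) (hp : p.Prime) (hp3 : 3 ≤ p) :
    maxIntegralCard p 2 = p := by
  haveI : Fact p.Prime := ⟨hp⟩
  have hub : ∀ k ∈ {k : ℕ | ∃ S : Finset (Fin 2 → ZMod p),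
      (∀ u ∈ S, ∀ v ∈ S, IntegralDistance p u v) ∧ S.card = k}, k ≤ p := by
    rintro k ⟨S, hS, rfl⟩
    exact integral_card_le p (by omega) S hS
  have hmem : p ∈ {k : ℕ | ∃ S : Finset (Fin 2 → ZMod p),
      (∀ u ∈ S, ∀ v ∈ S, IntegralDistance p u v) ∧ S.card = k} := by
    classical
    refine ⟨(Finset.univ : Finset (ZMod p)).image (fun t => ![t, 0]), ?_, ?_⟩
    · intro u hu v hv
      obtain ⟨s, -, rfl⟩ := Finset.mem_image.1 hu
      obtain ⟨t, -, rfl⟩ := Finset.mem_image.1 hv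
      exact ⟨s - t, by simp [Fin.sum_univ_two]⟩
    · rw [Finset.card_image_of_injective, Finset.card_univ, ZMod.card]
      intro s t h
      simpa using congrFun h 0
  exact le_antisymm (csSup_le ⟨p, hmem⟩ hub) (le_csSup ⟨p, hub⟩ hmem)
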